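/- arXiv:2102.06601 — 4 statements merged into one kernel-verified Lean document; each statement's English description precedes it below -/
import Mathlib

section
/- For every control pair (φ,ψ) ∈ V̂ × V̂ and every increment δφ ∈ V̂, the map φ ↦ J(φ,ψ) is Fréchet differentiable and its derivative at φ in the direction δφ equals the inner product ⟨B*p − B̂*p̂, δφ⟩_{V̂}, where p and p̂ are the adjoint states associated with (φ,ψ) and B*, B̂* denote Hilbert-space adjoints. -/
open ContinuousLinearMap
open scoped RealInnerProductSpace

variable {V Vh H : Type*}
  [NormedAddCommGroup V] [InnerProductSpace ℝ V] [CompleteSpace V]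
  [NormedAddCommGroup Vh] [InnerProductSpace ℝ Vh] [CompleteSpace Vh]
  [NormedAddCommGroup H] [InnerProductSpace ℝ H] [CompleteSpace H]

/-- The state `u(φ,ψ) = A⁻¹(Bφ + Cψ + F)`. -/
noncomputable def stateU (A : V ≃L[ℝ] V) (B C : Vh →L[ℝ] V) (F : V) (φ ψ : Vh) : V :=
  A.symm (B φ + C ψ + F)

/-- The state `û(φ,ψ) = Â⁻¹(−B̂φ + Ĉψ + G)`. -/
noncomputable def stateUh (Ah : Vh ≃L[ℝ] Vh) (Bh Ch : Vh →L[ℝ] Vh) (G : Vh) (φ ψ : Vh) : Vh :=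
  Ah.symm (-(Bh φ) + Ch ψ + G)

/-- The cost functional `J(φ,ψ) = ½‖γu − Eψ‖² + ½‖Eû − Eψ‖²`. -/
noncomputable def costJ (γ : V →L[ℝ] H) (E : Vh →L[ℝ] H) (A : V ≃L[ℝ] V) (Ah : Vh ≃L[ℝ] Vh)
    (B C : Vh →L[ℝ] V) (Bh Ch : Vh →L[ℝ] Vh) (F : V) (G : Vh) (φ ψ : Vh) : ℝ :=
  (1 / 2) * ‖γ (stateU A B C F φ ψ) - E ψ‖ ^ 2
    + (1 / 2) * ‖E (stateUh Ah Bh Ch G φ ψ) - E ψ‖ ^ 2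

theorem HasFDerivAt.half_norm_sq_adjoint {E F : Type*}
    [NormedAddCommGroup E] [InnerProductSpace ℝ E] [CompleteSpace E]
    [NormedAddCommGroup F] [InnerProductSpace ℝ F] [CompleteSpace F]
    {f : E → F} {f' : E →L[ℝ] F} {x : E} (hf : HasFDerivAt f f' x) :
    HasFDerivAt (fun y => (1 / 2) * ‖f y‖ ^ 2) (innerSL ℝ (adjoint f' (f x))) x := by
  refine (hf.norm_sq.const_mul (1 / 2 : ℝ)).congr_fderiv ?_
  ext v
  simp [adjoint_inner_left]

theorem ContinuousLinearEquiv.adjoint_symm_adjoint_apply {E : Type*}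
    [NormedAddCommGroup E] [InnerProductSpace ℝ E] [CompleteSpace E] (A : E ≃L[ℝ] E) (x : E) :
    adjoint (A.symm : E →L[ℝ] E) (adjoint (A : E →L[ℝ] E) x) = x := by
  rw [← comp_apply, ← adjoint_comp, A.coe_comp_coe_symm, adjoint_id, id_apply]

/-- The map `φ ↦ J(φ,ψ)` is Fréchet differentiable with derivative
`δφ ↦ ⟨B*p − B̂*p̂, δφ⟩` at `φ`, where `p`, `p̂` are the adjoint states, i.e.
`A*p = γ*(γu(φ,ψ) − Eψ)` and `Â*p̂ = E*(Eû(φ,ψ) − Eψ)`. -/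
theorem frechet_deriv_J_phi
    (γ : V →L[ℝ] H) (E : Vh →L[ℝ] H) (A : V ≃L[ℝ] V) (Ah : Vh ≃L[ℝ] Vh)
    (B C : Vh →L[ℝ] V) (Bh Ch : Vh →L[ℝ] Vh) (F : V) (G : Vh)
    (φ ψ : Vh) (p : V) (ph : Vh)
    (hp : adjoint (A : V →L[ℝ] V) p = adjoint γ (γ (stateU A B C F φ ψ) - E ψ))
    (hph : adjoint (Ah : Vh →L[ℝ] Vh) ph
        = adjoint E (E (stateUh Ah Bh Ch G φ ψ) - E ψ)) :
    HasFDerivAt (fun φ' => costJ γ E A Ah B C Bh Ch F G φ' ψ)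
      (innerSL ℝ (adjoint B p - adjoint Bh ph)) φ := by
  have hu : HasFDerivAt (fun φ' => γ (stateU A B C F φ' ψ) - E ψ)
      (γ ∘L (A.symm : V →L[ℝ] V) ∘L B) φ := by
    have h := ((B.hasFDerivAt (x := φ)).add_const (C ψ)).add_const F
    exact (γ.hasFDerivAt.comp φ ((A.symm : V →L[ℝ] V).hasFDerivAt.comp φ h)).sub_const (E ψ)
  have huh : HasFDerivAt (fun φ' => E (stateUh Ah Bh Ch G φ' ψ) - E ψ)
      (E ∘L (Ah.symm : Vh →L[ℝ] Vh) ∘L (-Bh)) φ := by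
    have h := (((-Bh).hasFDerivAt (x := φ)).add_const (Ch ψ)).add_const G
    exact (E.hasFDerivAt.comp φ ((Ah.symm : Vh →L[ℝ] Vh).hasFDerivAt.comp φ h)).sub_const (E ψ)
  refine (hu.half_norm_sq_adjoint.add huh.half_norm_sq_adjoint).congr_fderiv ?_
  rw [← map_add]
  simp only [adjoint_comp, comp_apply, ← hp, ← hph,
    ContinuousLinearEquiv.adjoint_symm_adjoint_apply, map_neg, neg_apply]
  rw [sub_eq_add_neg]
end

section
/- For every control pair (φ,ψ) ∈ V̂ × V̂ and every increment δψ ∈ V̂, the map ψ ↦ J(φ,ψ) is Fréchet differentiable and its derivative at ψ in the direction δψ equals the inner product ⟨C*p + Ĉ*p̂ − E*(γ u(φ,ψ) + E û(φ,ψ) − 2Eψ), δψ⟩_{V̂}, where p and p̂ are the adjoint states associated with (φ,ψ) and C*, Ĉ*, E* denote Hilbert-space adjoints. -/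
open ContinuousLinearMap
open scoped RealInnerProductSpace

variable {V Vh H : Type*}
  [NormedAddCommGroup V] [InnerProductSpace ℝ V] [CompleteSpace V]
  [NormedAddCommGroup Vh] [InnerProductSpace ℝ Vh] [CompleteSpace Vh]
  [NormedAddCommGroup H] [InnerProductSpace ℝ H] [CompleteSpace H]

/-- The gradient at `x` of the tracking term `½‖T w - E x‖²`, where the state `w` has derivative
`A⁻¹ C` at `x`, in terms of the adjoint state `p`. -/
theorem hasFDerivAt_half_norm_sq_of_adjoint_eq
    {W X Y : Type*}
    [NormedAddCommGroup W] [InnerProductSpace ℝ W] [CompleteSpace W]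
    [NormedAddCommGroup X] [InnerProductSpace ℝ X] [CompleteSpace X]
    [NormedAddCommGroup Y] [InnerProductSpace ℝ Y] [CompleteSpace Y]
    (T : W →L[ℝ] Y) (E : X →L[ℝ] Y) (A : W ≃L[ℝ] W) (C : X →L[ℝ] W)
    {w : X → W} {x : X} (hw : HasFDerivAt w ((A.symm : W →L[ℝ] W).comp C) x) {p : W}
    (hp : ContinuousLinearMap.adjoint (A : W →L[ℝ] W) p
        = ContinuousLinearMap.adjoint T (T (w x) - E x)) :
    HasFDerivAt (fun y => (1 / 2 : ℝ) * ‖T (w y) - E y‖ ^ 2)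
      (innerSL ℝ (ContinuousLinearMap.adjoint C p
        - ContinuousLinearMap.adjoint E (T (w x) - E x))) x := by
  have h := (((T.hasFDerivAt.comp x hw).sub E.hasFDerivAt).norm_sq).const_mul (1 / 2 : ℝ)
  refine h.congr_fderiv ?_
  ext v
  have key : ⟪T (w x) - E x, T (A.symm (C v))⟫ = ⟪p, C v⟫ := by
    rw [← ContinuousLinearMap.adjoint_inner_left, ← hp, ContinuousLinearMap.adjoint_inner_left]
    simp
  rw [innerSL_apply_apply, inner_sub_left, ContinuousLinearMap.adjoint_inner_left,
    ContinuousLinearMap.adjoint_inner_left, ← key, ← inner_sub_right]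
  simp [inner_sub_left, inner_sub_right]

/-- The map `ψ ↦ J(φ,ψ)` is Fréchet differentiable with derivative
`δψ ↦ ⟨C*p + Ĉ*p̂ − E*(γu + Eû − 2Eψ), δψ⟩` at `ψ`, where `p`, `p̂` are the adjoint
states associated with `(φ,ψ)`. -/
theorem frechet_deriv_J_psi
    (γ : V →L[ℝ] H) (E : Vh →L[ℝ] H) (A : V ≃L[ℝ] V) (Ah : Vh ≃L[ℝ] Vh)
    (B C : Vh →L[ℝ] V) (Bh Ch : Vh →L[ℝ] Vh) (F : V) (G : Vh)
    (φ ψ : Vh) (p : V) (ph : Vh)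
    (hp : ContinuousLinearMap.adjoint (A : V →L[ℝ] V) p
        = ContinuousLinearMap.adjoint γ (γ (stateU A B C F φ ψ) - E ψ))
    (hph : ContinuousLinearMap.adjoint (Ah : Vh →L[ℝ] Vh) ph
        = ContinuousLinearMap.adjoint E (E (stateUh Ah Bh Ch G φ ψ) - E ψ)) :
    HasFDerivAt (fun ψ' => costJ γ E A Ah B C Bh Ch F G φ ψ')
      (innerSL ℝ (ContinuousLinearMap.adjoint C p + ContinuousLinearMap.adjoint Ch ph
        - ContinuousLinearMap.adjoint E
            (γ (stateU A B C F φ ψ) + E (stateUh Ah Bh Ch G φ ψ) - 2 • E ψ))) ψ := by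
  have hu : HasFDerivAt (stateU A B C F φ) ((A.symm : V →L[ℝ] V).comp C) ψ :=
    (A.symm : V →L[ℝ] V).hasFDerivAt.comp ψ
      ((C.hasFDerivAt.const_add (B φ)).add_const F)
  have huh : HasFDerivAt (stateUh Ah Bh Ch G φ) ((Ah.symm : Vh →L[ℝ] Vh).comp Ch) ψ :=
    (Ah.symm : Vh →L[ℝ] Vh).hasFDerivAt.comp ψ
      ((Ch.hasFDerivAt.const_add (-(Bh φ))).add_const G)
  refine ((hasFDerivAt_half_norm_sq_of_adjoint_eq γ E A C hu hp).add
    (hasFDerivAt_half_norm_sq_of_adjoint_eq E E Ah Ch huh hph)).congr_fderiv ?_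
  rw [← map_add]
  congr 1
  simp only [map_sub, map_add, map_nsmul]
  module
end

section
/- If the control pair (φ,ψ) ∈ V̂ × V̂ is a global minimizer of J over V̂ × V̂, then the first-order optimality conditions B*p − B̂*p̂ = 0 and C*p + Ĉ*p̂ − E*(γ u(φ,ψ) + E û(φ,ψ) − 2Eψ) = 0 hold, where p and p̂ are the adjoint states associated with (φ,ψ). -/
open ContinuousLinearMap
open scoped RealInnerProductSpace

variable {V Vh H : Type*}
  [NormedAddCommGroup V] [InnerProductSpace ℝ V] [CompleteSpace V]
  [NormedAddCommGroup Vh] [InnerProductSpace ℝ Vh] [CompleteSpace Vh]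
  [NormedAddCommGroup H] [InnerProductSpace ℝ H] [CompleteSpace H]

/-- If `t = 0` minimizes `t ↦ ½‖a + t x‖² + ½‖b + t y‖²`, then its derivative there vanishes. -/
theorem inner_add_inner_eq_zero_of_min_along_line {W : Type*}
    [NormedAddCommGroup W] [InnerProductSpace ℝ W] (a b x y : W)
    (h : ∀ t : ℝ, (1 / 2) * ‖a‖ ^ 2 + (1 / 2) * ‖b‖ ^ 2
      ≤ (1 / 2) * ‖a + t • x‖ ^ 2 + (1 / 2) * ‖b + t • y‖ ^ 2) :
    ⟪a, x⟫ + ⟪b, y⟫ = 0 := by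
  have hq : ∀ t : ℝ, 0 ≤ ((‖x‖ ^ 2 + ‖y‖ ^ 2) / 2) * (t * t) + (⟪a, x⟫ + ⟪b, y⟫) * t + 0 := by
    intro t
    have ht := h t
    simp only [norm_add_sq_real, real_inner_smul_right, norm_smul, mul_pow, Real.norm_eq_abs,
      sq_abs] at ht
    linarith
  have hd := discrim_le_zero hq
  simp only [discrim, mul_zero, sub_zero] at hd
  exact pow_eq_zero_iff two_ne_zero |>.mp (le_antisymm hd (sq_nonneg _))

/-- An adjoint state `p` with `A* p = T* a` turns `⟪a, T A⁻¹ w⟫` into `⟪p, w⟫`. -/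
theorem inner_apply_symm_eq_of_adjoint_eq (A : V ≃L[ℝ] V) (T : V →L[ℝ] H) (p : V) (a : H)
    (hp : ContinuousLinearMap.adjoint (A : V →L[ℝ] V) p = ContinuousLinearMap.adjoint T a)
    (w : V) : ⟪a, T (A.symm w)⟫ = ⟪p, w⟫ := by
  rw [← adjoint_inner_left, ← hp, adjoint_inner_left, ContinuousLinearEquiv.coe_coe,
    A.apply_symm_apply]

theorem stateU_add_smul {W Z : Type*} [NormedAddCommGroup W] [InnerProductSpace ℝ W]
    [NormedAddCommGroup Z] [InnerProductSpace ℝ Z]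
    (A : W ≃L[ℝ] W) (B C : Z →L[ℝ] W) (F : W) (φ ψ dφ dψ : Z) (t : ℝ) :
    stateU A B C F (φ + t • dφ) (ψ + t • dψ)
      = stateU A B C F φ ψ + t • A.symm (B dφ + C dψ) := by
  simp only [stateU, map_add, map_smul, smul_add]
  abel

theorem stateUh_add_smul {Z : Type*} [NormedAddCommGroup Z] [InnerProductSpace ℝ Z]
    (Ah : Z ≃L[ℝ] Z) (Bh Ch : Z →L[ℝ] Z) (G φ ψ dφ dψ : Z) (t : ℝ) :
    stateUh Ah Bh Ch G (φ + t • dφ) (ψ + t • dψ)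
      = stateUh Ah Bh Ch G φ ψ + t • Ah.symm (-(Bh dφ) + Ch dψ) := by
  simp only [stateUh, map_add, map_smul, map_neg, smul_add, smul_neg, neg_add]
  abel

/-- If `(φ,ψ)` is a global minimizer of `J` over `V̂ × V̂`, then the first-order
optimality conditions `B*p − B̂*p̂ = 0` and
`C*p + Ĉ*p̂ − E*(γu + Eû − 2Eψ) = 0` hold, where `p`, `p̂` are the adjoint states. -/
theorem first_order_optimality_of_global_min
    (γ : V →L[ℝ] H) (E : Vh →L[ℝ] H) (A : V ≃L[ℝ] V) (Ah : Vh ≃L[ℝ] Vh)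
    (B C : Vh →L[ℝ] V) (Bh Ch : Vh →L[ℝ] Vh) (F : V) (G : Vh)
    (φ ψ : Vh) (p : V) (ph : Vh)
    (hp : ContinuousLinearMap.adjoint (A : V →L[ℝ] V) p
        = ContinuousLinearMap.adjoint γ (γ (stateU A B C F φ ψ) - E ψ))
    (hph : ContinuousLinearMap.adjoint (Ah : Vh →L[ℝ] Vh) ph
        = ContinuousLinearMap.adjoint E (E (stateUh Ah Bh Ch G φ ψ) - E ψ))
    (hmin : ∀ φ' ψ' : Vh, costJ γ E A Ah B C Bh Ch F G φ ψ
        ≤ costJ γ E A Ah B C Bh Ch F G φ' ψ') :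
    ContinuousLinearMap.adjoint B p - ContinuousLinearMap.adjoint Bh ph = 0 ∧
    ContinuousLinearMap.adjoint C p + ContinuousLinearMap.adjoint Ch ph
      - ContinuousLinearMap.adjoint E
          (γ (stateU A B C F φ ψ) + E (stateUh Ah Bh Ch G φ ψ) - 2 • E ψ) = 0 := by
  have key : ∀ dφ dψ : Vh,
      ⟪p, B dφ + C dψ⟫ - ⟪γ (stateU A B C F φ ψ) - E ψ, E dψ⟫
        + (⟪ph, -(Bh dφ) + Ch dψ⟫ - ⟪E (stateUh Ah Bh Ch G φ ψ) - E ψ, E dψ⟫) = 0 := by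
    intro dφ dψ
    rw [← inner_apply_symm_eq_of_adjoint_eq A γ p _ hp,
      ← inner_apply_symm_eq_of_adjoint_eq Ah E ph _ hph, ← inner_sub_right, ← inner_sub_right]
    refine inner_add_inner_eq_zero_of_min_along_line _ _ _ _ fun t => ?_
    have ht := hmin (φ + t • dφ) (ψ + t • dψ)
    simp only [costJ, stateU_add_smul, stateUh_add_smul, map_add, map_smul E, map_smul γ,
      add_sub_add_comm, ← smul_sub] at ht
    simpa only [map_add] using ht
  constructor
  · refine ext_inner_right ℝ fun v => ?_
    have hv := key v 0
    simp only [map_zero, add_zero, inner_zero_right, sub_zero, inner_neg_right] at hv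
    rw [inner_sub_left, adjoint_inner_left, adjoint_inner_left, inner_zero_left]
    linarith
  · refine ext_inner_right ℝ fun v => ?_
    have hv := key 0 v
    simp only [map_zero, neg_zero, zero_add, inner_sub_left] at hv
    simp only [inner_sub_left, inner_add_left, adjoint_inner_left, two_smul, inner_zero_left]
    linarith
end

section
/- Let (φ,ψ) ∈ V̂ × V̂ with adjoint states p, p̂, and let δφ = B*p − B̂*p̂ and δψ = C*p + Ĉ*p̂ − E*(γ u(φ,ψ) + E û(φ,ψ) − 2Eψ) be the steepest-descent increments; set δu = A⁻¹(Bδφ + Cδψ) and δû = Â⁻¹(−B̂δφ + Ĉδψ). Then the directional derivative expression satisfies the identity ⟨γ u(φ,ψ) − Eψ, γδu − Eδψ⟩_H + ⟨E û(φ,ψ) − Eψ, Eδû − Eδψ⟩_H = ‖δφ‖²_{V̂} + ‖δψ‖²_{V̂}. -/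
open ContinuousLinearMap
open scoped RealInnerProductSpace

variable {V Vh H : Type*}
  [NormedAddCommGroup V] [InnerProductSpace ℝ V] [CompleteSpace V]
  [NormedAddCommGroup Vh] [InnerProductSpace ℝ Vh] [CompleteSpace Vh]
  [NormedAddCommGroup H] [InnerProductSpace ℝ H] [CompleteSpace H]

/-- Pairing a residual `r` with the observation `γ (A⁻¹ w)` amounts to pairing the adjoint state
`p = (A*)⁻¹ γ* r` with the source `w`. -/
theorem inner_map_symm_eq_of_adjoint_eq {V H : Type*}
    [NormedAddCommGroup V] [InnerProductSpace ℝ V] [CompleteSpace V]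
    [NormedAddCommGroup H] [InnerProductSpace ℝ H] [CompleteSpace H]
    {γ : V →L[ℝ] H} {A : V ≃L[ℝ] V} {p : V} {r : H}
    (hp : ContinuousLinearMap.adjoint (A : V →L[ℝ] V) p = ContinuousLinearMap.adjoint γ r)
    (w : V) : ⟪r, γ (A.symm w)⟫ = ⟪p, w⟫ := by
  rw [← ContinuousLinearMap.adjoint_inner_left, ← hp, ContinuousLinearMap.adjoint_inner_left]
  simp

/-- The directional derivative of `J` along the steepest-descent increments equals
`‖δφ‖² + ‖δψ‖²`. -/
theorem steepest_descent_directional_derivative_identity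
    (γ : V →L[ℝ] H) (E : Vh →L[ℝ] H) (A : V ≃L[ℝ] V) (Ah : Vh ≃L[ℝ] Vh)
    (B C : Vh →L[ℝ] V) (Bh Ch : Vh →L[ℝ] Vh) (F : V) (G : Vh)
    (φ ψ : Vh) (p : V) (ph : Vh)
    (hp : ContinuousLinearMap.adjoint (A : V →L[ℝ] V) p
        = ContinuousLinearMap.adjoint γ (γ (stateU A B C F φ ψ) - E ψ))
    (hph : ContinuousLinearMap.adjoint (Ah : Vh →L[ℝ] Vh) ph
        = ContinuousLinearMap.adjoint E (E (stateUh Ah Bh Ch G φ ψ) - E ψ))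
    (δφ δψ : Vh) (δu : V) (δuh : Vh)
    (hδφ : δφ = ContinuousLinearMap.adjoint B p - ContinuousLinearMap.adjoint Bh ph)
    (hδψ : δψ = ContinuousLinearMap.adjoint C p + ContinuousLinearMap.adjoint Ch ph
        - ContinuousLinearMap.adjoint E
            (γ (stateU A B C F φ ψ) + E (stateUh Ah Bh Ch G φ ψ) - 2 • E ψ))
    (hδu : δu = A.symm (B δφ + C δψ))
    (hδuh : δuh = Ah.symm (-(Bh δφ) + Ch δψ)) :
    ⟪γ (stateU A B C F φ ψ) - E ψ, γ δu - E δψ⟫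
      + ⟪E (stateUh Ah Bh Ch G φ ψ) - E ψ, E δuh - E δψ⟫
      = ‖δφ‖ ^ 2 + ‖δψ‖ ^ 2 := by
  have hφ : ‖δφ‖ ^ 2 = ⟪p, B δφ⟫ - ⟪ph, Bh δφ⟫ := by
    rw [← real_inner_self_eq_norm_sq]
    nth_rewrite 1 [hδφ]
    simp only [inner_sub_left, ContinuousLinearMap.adjoint_inner_left]
  have hψ : ‖δψ‖ ^ 2 = ⟪p, C δψ⟫ + ⟪ph, Ch δψ⟫
      - (⟪γ (stateU A B C F φ ψ) - E ψ, E δψ⟫ + ⟪E (stateUh Ah Bh Ch G φ ψ) - E ψ, E δψ⟫) := by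
    rw [← real_inner_self_eq_norm_sq]
    nth_rewrite 1 [hδψ]
    rw [inner_sub_left, inner_add_left, ContinuousLinearMap.adjoint_inner_left,
      ContinuousLinearMap.adjoint_inner_left, ContinuousLinearMap.adjoint_inner_left,
      ← inner_add_left, two_nsmul, add_sub_add_comm]
  rw [inner_sub_right, inner_sub_right, hδu, hδuh, inner_map_symm_eq_of_adjoint_eq hp,
    inner_map_symm_eq_of_adjoint_eq hph, hφ, hψ]
  simp only [inner_add_right, inner_neg_right]
  ring
end
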